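/- For all i, j ∈ I the double-expansion coefficients of the inverse deformed Cartan matrix satisfy: (1) c̃_{ij}(u, v) = 0 whenever u ≤ d_i or v ≥ −1, except possibly for (u, v) = (d_i, −1); and (2) c̃_{ij}(d_i, −1) = δ_{ij} (Kronecker delta). -/

import Mathlib

noncomputable section

open scoped BigOperators

/-- The field `K = ℚ(q,t)` of rational functions in two variables over `ℚ`. -/
abbrev KK : Type := FractionRing (MvPolynomial (Fin 2) ℚ)

/-- The variable `q` of `ℚ(q,t)`. -/
def qv : KK := algebraMap (MvPolynomial (Fin 2) ℚ) KK (MvPolynomial.X 0)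

/-- The variable `t` of `ℚ(q,t)`. -/
def tv : KK := algebraMap (MvPolynomial (Fin 2) ℚ) KK (MvPolynomial.X 1)

/-- The quantum integer `[k]_q = (q^k - q^{-k})/(q - q⁻¹)` in `ℚ(q,t)`. -/
def qint (k : ℤ) : KK := (qv ^ k - qv ^ (-k)) / (qv - qv⁻¹)

variable {I : Type}

/-- The `(q,t)`-deformed Cartan matrix `C(q,t)`:
`C_{ii} = q^{d_i} t⁻¹ + q^{-d_i} t` and `C_{ij} = [c_{ij}]_q` for `i ≠ j`. -/
def Cqt [DecidableEq I] (c : I → I → ℤ) (d : I → ℤ) (i j : I) : KK :=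
  if i = j then qv ^ (d i) * tv⁻¹ + qv ^ (-(d i)) * tv else qint (c i j)

/-- The basis vector `α_i` of `V = K^{⊕I}`. -/
def alphaK [DecidableEq I] (i : I) : I → KK := Pi.single i 1

/-- The deformed bilinear form `B` on `V`, determined by
`B(α_i, α_j) = [d_i]_q C_{ij}(q,t)`. -/
def Bform [Fintype I] [DecidableEq I] (c : I → I → ℤ) (d : I → ℤ)
    (lam mu : I → KK) : KK :=
  ∑ i, ∑ j, lam i * mu j * (qint (d i) * Cqt c d i j)

/-- The operator `T_i : V → V`, `T_i(λ) = λ - (q^{-d_i} t/[d_i]_q)·B(α_i, λ)·α_i`. -/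
def Trefl [Fintype I] [DecidableEq I] (c : I → I → ℤ) (d : I → ℤ) (i : I)
    (lam : I → KK) : I → KK :=
  fun k => lam k - (qv ^ (-(d i)) * tv / qint (d i)) * Bform c d (alphaK i) lam * alphaK i k

/-- The field `ℚ((q))` of formal Laurent series. -/
abbrev FF : Type := LaurentSeries ℚ

/-- The field `ℚ((q))((t⁻¹))` of iterated formal Laurent series: the outer variable is
`s = t⁻¹`, so that Laurent expansion in `t⁻¹` (expansion at `t = ∞`) followed by Laurent
expansion at `q = 0` lands in this field. -/
abbrev LL : Type := LaurentSeries FF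

/-- The image of `q` in `ℚ((q))((t⁻¹))`. -/
def qL : LL := HahnSeries.C (HahnSeries.single (1 : ℤ) (1 : ℚ))

/-- The image of `t` in `ℚ((q))((t⁻¹))`: the inverse `s⁻¹` of the outer variable,
i.e. the monomial with outer exponent `-1`. -/
def tL : LL := HahnSeries.single (-1 : ℤ) (1 : FF)

/-- The coefficient of `q^u t^v` of an element of `ℚ((q))((t⁻¹))` (the coefficient of
`t^v`, i.e. of outer exponent `-v`, is a Laurent series in `q`, of which we take the
coefficient of `q^u`). -/
def dcoeff (x : LL) (u v : ℤ) : ℚ := (x.coeff (-v)).coeff u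

/-- The variable `q` in `ℚ((q))`. -/
def qF : FF := HahnSeries.single (1 : ℤ) (1 : ℚ)

lemma qF_ne : qF ≠ 0 := HahnSeries.single_ne_zero one_ne_zero

lemma qF_zpow (n : ℤ) : qF ^ n = HahnSeries.single n (1 : ℚ) := by
  have h1 : ∀ m : ℕ, qF ^ m = HahnSeries.single (m : ℤ) (1 : ℚ) := by
    intro m
    simp [qF, HahnSeries.single_pow]
  obtain ⟨m, rfl | rfl⟩ := n.eq_nat_or_neg
  · rw [zpow_natCast, h1]
  · rw [zpow_neg, zpow_natCast, h1, HahnSeries.inv_single, inv_one]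

/-- `x` is divisible by `q^n`. -/
def VP (n : ℤ) (x : FF) : Prop := ∀ u < n, x.coeff u = 0

lemma VP.zero (n : ℤ) : VP n 0 := fun _ _ => rfl

lemma VP.mono {m n : ℤ} {x : FF} (h : VP n x) (hmn : m ≤ n) : VP m x :=
  fun u hu => h u (lt_of_lt_of_le hu hmn)

lemma VP.add {n : ℤ} {x y : FF} (hx : VP n x) (hy : VP n y) : VP n (x + y) := fun u hu => by
  rw [HahnSeries.coeff_add, hx u hu, hy u hu, add_zero]

lemma VP.neg {n : ℤ} {x : FF} (hx : VP n x) : VP n (-x) := fun u hu => by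
  rw [HahnSeries.coeff_neg, hx u hu, neg_zero]

lemma VP.sub {n : ℤ} {x y : FF} (hx : VP n x) (hy : VP n y) : VP n (x - y) := by
  rw [sub_eq_add_neg]; exact hx.add hy.neg

lemma VP.sum {J : Type} {n : ℤ} (s : Finset J) {x : J → FF} (hx : ∀ i ∈ s, VP n (x i)) :
    VP n (∑ i ∈ s, x i) := fun u hu => by
  rw [HahnSeries.coeff_sum]
  exact Finset.sum_eq_zero fun i hi => hx i hi u hu

lemma VP.mul {m n : ℤ} {x y : FF} (hx : VP m x) (hy : VP n y) : VP (m + n) (x * y) :=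
  fun u hu => by
  rw [HahnSeries.coeff_mul]
  refine Finset.sum_eq_zero fun p hp => ?_
  have h := (Finset.mem_antidiagonal.mp hp).2.2
  by_cases h1 : p.1 < m
  · rw [hx _ h1, zero_mul]
  · rw [hy p.2 (by omega), mul_zero]

lemma VP.zpow (n : ℤ) : VP n (qF ^ n) := fun u hu => by
  rw [qF_zpow, HahnSeries.coeff_single_of_ne hu.ne]

/-- The quantum integer in `ℚ((q))`. -/
def qiF (k : ℤ) : FF := (qF ^ k - qF ^ (-k)) / (qF - qF⁻¹)

lemma qF_sub_ne : qF - qF⁻¹ ≠ 0 := by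
  intro h
  have h2 : (qF - qF⁻¹).coeff 1 = 1 := by
    rw [HahnSeries.coeff_sub, ← zpow_neg_one, qF_zpow, qF, HahnSeries.coeff_single_same,
      HahnSeries.coeff_single_of_ne (by norm_num), sub_zero]
  rw [h] at h2
  simp at h2

lemma qiF_zero : qiF 0 = 0 := by simp [qiF]

lemma qiF_val (m : ℕ) : VP (1 - (m : ℤ)) (qiF (-(m : ℤ))) := by
  induction m with
  | zero => simpa [qiF_zero] using VP.zero _
  | succ m ih =>
    have key : qiF (-((m + 1 : ℕ) : ℤ)) = qF ^ (1 : ℤ) * qiF (-(m : ℤ)) - qF ^ (-(m : ℤ)) := by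
      have h := qF_sub_ne
      have hq := qF_ne
      unfold qiF
      rw [eq_sub_iff_add_eq, mul_div_assoc', div_add' _ _ _ h]
      congr 1
      push_cast
      rw [neg_neg, neg_neg, neg_add, zpow_add₀ hq, zpow_add₀ hq, zpow_neg_one, zpow_one]
      ring
    rw [key]
    refine VP.sub (((VP.zpow 1).mul ih).mono ?_) ((VP.zpow _).mono ?_) <;> push_cast <;> omega

section core

variable {J : Type} [Fintype J]

/-- Vanishing below a given outer exponent. -/
lemma core_vanish (x : J → LL) (a : J → FF) (g : J → J → FF) (M : ℤ)
    (h : ∀ i n, n + 1 < M → (x i).coeff (n + 1) =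
      a i * (x i).coeff (n - 1) + ∑ k, g i k * (x k).coeff n) :
    ∀ n < M, ∀ i, (x i).coeff n = 0 := by
  obtain ⟨N, hN⟩ : ∃ N : ℤ, ∀ i, N ≤ (x i).order := by
    obtain ⟨N, hN⟩ := (Set.finite_range fun i => (x i).order).bddBelow
    exact ⟨N, fun i => hN ⟨i, rfl⟩⟩
  have key : ∀ k : ℕ, ∀ n : ℤ, n < N + k → n < M → ∀ i, (x i).coeff n = 0 := by
    intro k
    induction k with
    | zero =>
      intro n hn _ i
      exact HahnSeries.coeff_eq_zero_of_lt_order (by have := hN i; push_cast at hn; omega)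
    | succ k ih =>
      intro n hn hM i
      push_cast at hn
      have := h i (n - 1) (by omega)
      rw [sub_add_cancel] at this
      rw [this, ih (n - 1 - 1) (by omega) (by omega) i, mul_zero, zero_add]
      refine Finset.sum_eq_zero fun k _ => ?_
      rw [ih (n - 1) (by omega) (by omega) k, mul_zero]
  intro n hn i
  exact key (n + 1 - N).toNat n (by omega) hn i

lemma core_val (d : J → ℤ) (hd : ∀ i, 0 < d i) (x : J → LL) (f : J → FF) (g : J → J → FF)
    (hf : ∀ i, VP 0 (f i)) (hg : ∀ i k, VP (1 - d k) (g i k))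
    (h : ∀ i n, (x i).coeff (n + 1) =
      qF ^ d i * ((if n = 0 then f i else 0) - qF ^ d i * (x i).coeff (n - 1)
        - ∑ k, g i k * (x k).coeff n)) :
    (∀ n < 1, ∀ i, (x i).coeff n = 0) ∧ (∀ i, (x i).coeff 1 = qF ^ d i * f i) ∧
    (∀ n, 1 < n → ∀ i, VP (d i + 1) ((x i).coeff n)) := by
  have h0 : ∀ n < 1, ∀ i, (x i).coeff n = 0 := by
    refine core_vanish x (fun i => - (qF ^ d i * qF ^ d i)) (fun i k => - (qF ^ d i * g i k)) 1 ?_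
    intro i n hn
    rw [h, if_neg (by omega), mul_sub, Finset.mul_sum]
    simp only [neg_mul, Finset.sum_neg_distrib, mul_assoc]
    ring
  have h1 : ∀ i, (x i).coeff 1 = qF ^ d i * f i := by
    intro i
    have := h i 0
    rw [zero_add] at this
    rw [this, if_pos rfl, h0 (0 - 1) (by norm_num)]
    simp [h0 0 (by norm_num)]
  have hw : ∀ k : ℕ, ∀ n : ℤ, n < 2 + k → ∀ i, VP (d i) ((x i).coeff n) ∧
      (1 < n → VP (d i + 1) ((x i).coeff n)) := by
    intro k
    induction k with
    | zero =>
      intro n hn i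
      push_cast at hn
      refine ⟨?_, fun _ => by omega⟩
      by_cases hn1 : n = 1
      · subst hn1
        rw [h1]
        exact ((VP.zpow _).mul (hf i)).mono (by omega)
      · rw [h0 n (by omega)]
        exact VP.zero _
    | succ k ih =>
      intro n hn i
      push_cast at hn
      by_cases hlt : n < 2 + k
      · exact ih n hlt i
      have hv : VP (d i + 1) ((x i).coeff n) := by
        have hh := h i (n - 1)
        rw [sub_add_cancel] at hh
        rw [hh, if_neg (by omega)]
        have hdi := hd i
        refine (VP.zpow (d i)).mul (VP.sub (VP.sub (VP.zero _) ?_) (VP.sum _ fun k _ => ?_))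
        · exact ((VP.zpow (d i)).mul (ih (n - 1 - 1) (by omega) i).1).mono (by omega)
        · exact ((hg i k).mul (ih (n - 1) (by omega) k).1).mono (by omega)
      exact ⟨hv.mono (by omega), fun _ => hv⟩
  refine ⟨h0, h1, fun n hn i => (hw n.toNat n (by omega) i).2 hn⟩

end core

lemma phi_qint (φ : KK →+* LL) (hφq : φ qv = qL) (k : ℤ) :
    φ (qint k) = HahnSeries.C (qiF k) := by
  have : qL = HahnSeries.C qF := rfl
  simp only [qint, qiF, map_div₀, map_sub, map_zpow₀, map_inv₀, hφq, this]

/-- The linear system in coefficient form. -/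
lemma row_coeff {J : Type} [Fintype J] [DecidableEq J] (c : J → J → ℤ) (d : J → ℤ)
    (φ : KK →+* LL) (hφq : φ qv = qL) (hφt : φ tv = tL) (x : J → LL) (f : J → FF)
    (hx : ((Matrix.of (Cqt c d)).map φ).mulVec x = fun i => HahnSeries.C (f i)) (i : J) (n : ℤ) :
    (x i).coeff (n + 1) =
      qF ^ d i * ((if n = 0 then f i else 0) - qF ^ d i * (x i).coeff (n - 1)
        - ∑ k, (if i = k then 0 else qiF (c i k)) * (x k).coeff n) := by
  have hi := congrFun hx i
  have hent : ∀ k, φ (Cqt c d i k) = HahnSeries.C (if i = k then 0 else qiF (c i k)) +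
      (if i = k then HahnSeries.single (1 : ℤ) (qF ^ d i) + HahnSeries.single (-1 : ℤ) (qF ^ (- d i))
        else 0) := by
    intro k
    have hq : qL = HahnSeries.C qF := rfl
    by_cases hik : i = k
    · subst hik
      simp only [Cqt, if_true, map_add, map_mul, map_zpow₀, map_inv₀, hφq, hφt, hq, map_zero,
        zero_add]
      rw [← map_zpow₀, ← map_zpow₀, tL, HahnSeries.inv_single, neg_neg, inv_one,
        HahnSeries.C_apply, HahnSeries.C_apply, HahnSeries.single_mul_single,
        HahnSeries.single_mul_single]
      simp
    · simp only [Cqt, if_neg hik, add_zero]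
      exact phi_qint φ hφq _
  simp only [Matrix.mulVec, dotProduct, Matrix.map_apply, Matrix.of_apply, hent, add_mul,
    Finset.sum_add_distrib, ite_mul, zero_mul, Finset.sum_ite_eq, Finset.mem_univ, if_true] at hi
  have hc := congrArg (fun y : LL => y.coeff n) hi
  simp only [HahnSeries.coeff_add, HahnSeries.coeff_sum, HahnSeries.C_apply,
    HahnSeries.coeff_single_mul, sub_neg_eq_add, sub_zero] at hc
  have hs : ((HahnSeries.single (0 : ℤ)) (f i) : LL).coeff n = if n = 0 then f i else 0 := by
    split_ifs with h
    · rw [h, HahnSeries.coeff_single_same]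
    · rw [HahnSeries.coeff_single_of_ne h]
  rw [hs] at hc
  have hz : qF ^ d i * qF ^ (- d i) = 1 := by
    rw [← zpow_add₀ qF_ne, add_neg_cancel, zpow_zero]
  rw [← hc]
  linear_combination (-(x i).coeff (n + 1)) * hz

theorem statement_4
    {I : Type} [Fintype I] [DecidableEq I] [Nonempty I]
    (c : I → I → ℤ) (d : I → ℤ) (r : ℤ)
    -- `C` is a symmetrizable generalized Cartan matrix
    (hdiag : ∀ i, c i i = 2)
    (hoff : ∀ i j, i ≠ j → c i j ≤ 0)
    -- `(d_i)` are positive integers with gcd 1 symmetrizing `C`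
    (hdpos : ∀ i, 0 < d i)
    (hgcd : Finset.univ.gcd d = 1)
    (hsymm : ∀ i j, d i * c i j = d j * c j i)
    -- each `d_i ∈ {1, r}` where `r = max_i d_i`
    (honer : ∀ i, d i = 1 ∨ d i = r)
    (hrmax : ∀ i, d i ≤ r)
    (hrmem : ∃ i, d i = r)
    -- `d_i c_{ij} = -max(d_i, d_j)` whenever `i ≠ j` and `c_{ij} ≠ 0`
    (hbmax : ∀ i j, i ≠ j → c i j ≠ 0 → d i * c i j = -(max (d i) (d j)))
    -- `φ` is the double Laurent expansion of `ℚ(q,t)`: first in `t⁻¹` (at `t = ∞`),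
    -- then at `q = 0`; it is the unique ring homomorphism `ℚ(q,t) → ℚ((q))((t⁻¹))`
    -- sending `q`, `t` to their canonical images
    (φ : KK →+* LL)
    (hφq : φ qv = qL)
    (hφt : φ tv = tL)
    :
    ∀ (i j : I) (u v : ℤ),
      (((u ≤ d i ∨ -1 ≤ v) ∧ (u, v) ≠ (d i, -1)) →
        dcoeff (φ ((Matrix.of (Cqt c d))⁻¹ i j)) u v = 0) ∧
      dcoeff (φ ((Matrix.of (Cqt c d))⁻¹ i j)) (d i) (-1) = (if i = j then 1 else 0)
    := by
  have hg : ∀ i k, VP (1 - d k) (if i = k then 0 else qiF (c i k)) := by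
    intro i k
    by_cases hik : i = k
    · rw [if_pos hik]; exact VP.zero _
    rw [if_neg hik]
    have hneg := hoff i k hik
    obtain ⟨m, hm⟩ : ∃ m : ℕ, c i k = -(m : ℤ) := ⟨(- c i k).toNat, by omega⟩
    rw [hm]
    refine (qiF_val m).mono ?_
    have hk := hdpos k
    have hi := hdpos i
    have hrk := hrmax k
    by_cases h0 : c i k = 0
    · omega
    have hb := hbmax i k hik h0
    rcases le_total (d k) (d i) with h | h
    · rw [max_eq_left h] at hb
      have : c i k = -1 := by
        apply mul_left_cancel₀ hi.ne'
        rw [hb]; ring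
      omega
    · rw [max_eq_right h] at hb
      rcases honer i with h1 | h1
      · rw [h1] at hb; omega
      · have hde : d k = d i := by omega
        have : c i k = -1 := by
          apply mul_left_cancel₀ hi.ne'
          rw [hb, hde]; ring
        omega
  have hdet : (Matrix.of (Cqt c d)).det ≠ 0 := by
    intro hd0
    obtain ⟨w, hw0, hw⟩ := Matrix.exists_mulVec_eq_zero_iff.mpr hd0
    apply hw0
    have hx : ((Matrix.of (Cqt c d)).map φ).mulVec (fun i => φ (w i)) =
        fun _ => HahnSeries.C (0 : FF) := by
      funext i
      have := congrArg φ (congrFun hw i)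
      simpa [Matrix.mulVec, dotProduct, map_sum] using this
    have hrow := row_coeff c d φ hφq hφt _ _ hx
    funext i
    have hz : φ (w i) = 0 := by
      ext1
      funext n
      refine core_vanish (fun i => φ (w i)) (fun i => - (qF ^ d i * qF ^ d i))
        (fun i k => - (qF ^ d i * (if i = k then 0 else qiF (c i k)))) (n + 1) ?_ n (by omega) i
      intro i n _
      rw [hrow, ite_self, mul_sub, Finset.mul_sum]
      simp only [neg_mul, Finset.sum_neg_distrib, mul_assoc]
      ring
    exact (map_eq_zero φ).mp hz
  intro i j u v
  have hx : ((Matrix.of (Cqt c d)).map φ).mulVec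
      (fun i => φ ((Matrix.of (Cqt c d))⁻¹ i j)) =
        fun i => HahnSeries.C (if i = j then (1 : FF) else 0) := by
    funext i
    have h1 := Matrix.mul_nonsing_inv (Matrix.of (Cqt c d)) (isUnit_iff_ne_zero.mpr hdet)
    have h2 := congrArg φ (congrFun (congrFun h1 i) j)
    rw [Matrix.mul_apply, map_sum, Matrix.one_apply] at h2
    simp only [map_mul] at h2
    simp only [Matrix.mulVec, dotProduct, Matrix.map_apply]
    rw [h2]
    split_ifs <;> simp
  have hf : ∀ i, VP 0 (if i = j then (1 : FF) else 0) := by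
    intro i
    split_ifs
    · simpa using VP.zpow 0
    · exact VP.zero _
  obtain ⟨ha, hb, hc⟩ := core_val d hdpos _ _ _ hf hg (row_coeff c d φ hφq hφt _ _ hx)
  have hb' := hb i
  unfold dcoeff
  constructor
  · rintro ⟨huv, hne⟩
    rcases lt_trichotomy (-v) 1 with h | h | h
    · rw [ha (-v) h i]; rfl
    · rw [h, hb']
      have hu : u ≠ d i := by
        rintro rfl
        apply hne
        rw [show v = -1 by omega]
      split_ifs
      · rw [mul_one, qF_zpow, HahnSeries.coeff_single_of_ne hu]
      · simp
    · exact hc (-v) h i u (by omega)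
  · rw [neg_neg, hb']
    split_ifs
    · rw [mul_one, qF_zpow, HahnSeries.coeff_single_same]
    · simp
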